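/- arXiv:1403.0435 — 3 statements merged into one kernel-verified Lean document; each statement's English description precedes it below -/
import Mathlib

section
/- (Ramanujan) For every odd integer n ≥ 3, Σ_{0 ≤ k ≤ n, k ≡ 3 (mod 6)} C(n,k) B_{n-k} equals −n/6 if n ≡ 1 (mod 6), and equals n/3 if n ≡ 3 or 5 (mod 6). -/
open Finset

section BernoulliPolynomial

variable {A : Type*} [CommRing A] [Algebra ℚ A]

theorem Polynomial.aeval_bernoulli (n : ℕ) (x : A) :
    aeval x (Polynomial.bernoulli n) =
      ∑ k ∈ range (n + 1), algebraMap ℚ A (n.choose k * _root_.bernoulli (n - k)) * x ^ k := by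
  simp [bernoulli_def, aeval_monomial, mul_comm]

theorem Polynomial.aeval_bernoulli_one_add (n : ℕ) (x : A) :
    aeval (1 + x) (Polynomial.bernoulli n) =
      aeval x (Polynomial.bernoulli n) + n * x ^ (n - 1) := by
  simpa [aeval_comp] using congrArg (aeval x) (bernoulli_comp_one_add_X n)

end BernoulliPolynomial

/-- The alternating sum over the sixth roots of unity detects exponents congruent to `3` mod `6`. -/
theorem alternating_sum_sixth_roots_pow {R : Type*} [CommRing R] {w : R} (hw : w ^ 2 = w - 1)
    (k : ℕ) :
    1 ^ k - w ^ k + (w - 1) ^ k - (-1) ^ k + (-w) ^ k - (1 - w) ^ k =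
      if k % 6 = 3 then 6 else 0 := by
  have h3 : w ^ 3 = -1 := by linear_combination (w + 1) * hw
  have h6 : w ^ 6 = 1 := by linear_combination (w ^ 3 - 1) * h3
  have period {x : R} (hx : x ^ 6 = 1) : x ^ k = x ^ (k % 6) := pow_eq_pow_mod k hx
  have h2 : (w - 1) ^ 6 = 1 := by rw [← hw, ← pow_mul, mul_comm, pow_mul, h6, one_pow]
  rw [one_pow, period h6, period h2, period (x := -1) (by norm_num),
    period (x := -w) (by rw [Even.neg_pow (by decide), h6]),
    period (x := 1 - w) (by rw [← neg_sub, Even.neg_pow (by decide), h2])]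
  have hlt : k % 6 < 6 := Nat.mod_lt _ (by norm_num)
  generalize k % 6 = r at hlt
  interval_cases r <;> norm_num <;> grind

theorem Complex.exists_sq_eq_sub_one : ∃ w : ℂ, w ^ 2 = w - 1 := by
  obtain ⟨s, hs⟩ := IsAlgClosed.exists_pow_nat_eq (-3 : ℂ) (n := 2) (by norm_num)
  exact ⟨(1 + s) / 2, by linear_combination hs / 4⟩

theorem ramanujan_sum_bernoulli_mod_six (n : ℕ) (hn : 3 ≤ n) (hodd : Odd n) :
    ∑ k ∈ (Finset.range (n + 1)).filter (fun k => k % 6 = 3),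
      (n.choose k : ℚ) * bernoulli (n - k)
    = if n % 6 = 1 then -(n : ℚ) / 6 else (n : ℚ) / 3 := by
  obtain ⟨w, hw⟩ := Complex.exists_sq_eq_sub_one
  set S := ∑ k ∈ (Finset.range (n + 1)).filter (fun k => k % 6 = 3),
      (n.choose k : ℚ) * bernoulli (n - k) with hS
  let f : ℂ → ℂ := fun x => Polynomial.aeval x (Polynomial.bernoulli n)
  have hsum : f 1 - f w + f (w - 1) - f (-1) + f (-w) - f (1 - w) = 6 * (S : ℂ) := by
    simp only [f, Polynomial.aeval_bernoulli, ← sum_sub_distrib, ← sum_add_distrib, ← mul_sub,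
      ← mul_add, alternating_sum_sixth_roots_pow hw]
    rw [hS, sum_filter, Rat.cast_sum, mul_sum]
    refine sum_congr rfl fun k _ => ?_
    split_ifs <;> simp [mul_comm]
  have hadd (x : ℂ) : f (1 + x) = f x + n * x ^ (n - 1) :=
    Polynomial.aeval_bernoulli_one_add n x
  have heven : Even (n - 1) := hodd.tsub_odd odd_one
  have h0 : f 1 = f 0 := by simpa [show n - 1 ≠ 0 by omega] using hadd 0
  have h1 : f 0 = f (-1) + n := by simpa [heven.neg_one_pow] using hadd (-1)
  have h2 : f w = f (w - 1) + n * (w - 1) ^ (n - 1) := by simpa using hadd (w - 1)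
  have h4 : f (1 - w) = f (-w) + n * w ^ (n - 1) := by
    simpa [heven.neg_pow, sub_eq_add_neg] using hadd (-w)
  have hS6 : 6 * (S : ℂ) = n * (1 - (w - 1) ^ (n - 1) - w ^ (n - 1)) := by
    linear_combination -hsum + h0 + h1 - h2 - h4
  have hpow : (w - 1) ^ (n - 1) + w ^ (n - 1) = if n % 6 = 1 then 2 else -1 := by
    have h3 : w ^ 3 = -1 := by linear_combination (w + 1) * hw
    have h6 : w ^ 6 = 1 := by linear_combination (w ^ 3 - 1) * h3
    have h6' : (w - 1) ^ 6 = 1 := by rw [← hw, ← pow_mul, mul_comm, pow_mul, h6, one_pow]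
    rw [pow_eq_pow_mod _ h6, pow_eq_pow_mod _ h6']
    have : n % 6 = 1 ∨ n % 6 = 3 ∨ n % 6 = 5 := by have := Nat.odd_iff.mp hodd; omega
    rcases this with h | h | h
    · rw [show (n - 1) % 6 = 0 by omega, if_pos h]; norm_num
    · rw [show (n - 1) % 6 = 2 by omega, if_neg (by omega)]; linear_combination 2 * hw
    · rw [show (n - 1) % 6 = 4 by omega, if_neg (by omega)]; grind
  have : (S : ℂ) = ((if n % 6 = 1 then -(n : ℚ) / 6 else (n : ℚ) / 3 : ℚ) : ℂ) := by
    split_ifs at hpow ⊢ <;> push_cast <;> linear_combination hS6 / 6 - n * hpow / 6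
  exact_mod_cast this
end

section
/- Let m be a positive integer and let n ≥ 3 be odd. Then Σ_{0 ≤ k ≤ n, k ≡ 3 (mod 6)} C(n,k) m^k B_{n-k} = (n/3) { Σ_{r=1}^{m-1} r^{n-1} − Σ_{r=1}^{⌊(m-1)/2⌋} ( (r+mω)^{n-1} + (r+mω²)^{n-1} ) + δ(m,n) }, where δ(m,n) = −m^{n-1}/2 if m is odd and 3 | n−1; δ(m,n) = m^{n-1} if m is odd and 3 ∤ n−1; δ(m,n) = −m^{n-1}/2 − (−3)^{(n-1)/2} (m/2)^{n-1} if m is even and 3 | n−1; and δ(m,n) = m^{n-1} − (−3)^{(n-1)/2} (m/2)^{n-1} if m is even and 3 ∤ n−1. -/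
open Finset

/-- `ω = (-1 + √(-3))/2`, a primitive cube root of unity. -/
noncomputable def ω : ℂ := (-1 + (Real.sqrt 3 : ℂ) * Complex.I) / 2

theorem omega_sq_add_omega_add_one : ω ^ 2 + ω + 1 = 0 := by
  have h : (Real.sqrt 3 : ℂ) ^ 2 = 3 := by
    rw [← Complex.ofReal_pow, Real.sq_sqrt (by norm_num)]; norm_num
  unfold ω
  linear_combination Complex.I ^ 2 / 4 * h + 3 / 4 * Complex.I_sq

theorem omega_pow_three : ω ^ 3 = 1 := by
  linear_combination (ω - 1) * omega_sq_add_omega_add_one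

theorem omega_pow_add_omega_sq_pow (k : ℕ) :
    ω ^ k + (ω ^ 2) ^ k = if k % 3 = 0 then 2 else -1 := by
  have h (j : ℕ) : ω ^ (3 * j) = 1 := by rw [pow_mul, omega_pow_three, one_pow]
  rw [← pow_mul, mul_comm, pow_mul, ← Nat.div_add_mod k 3, pow_add, h, one_mul,
    Nat.mul_add_mod, Nat.mod_mod]
  have : k % 3 < 3 := Nat.mod_lt _ (by norm_num)
  interval_cases k % 3
  · norm_num
  · norm_num
    linear_combination omega_sq_add_omega_add_one
  · norm_num
    linear_combination omega_sq_add_omega_add_one + ω * omega_pow_three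

section BernoulliPolynomial

variable {A : Type*} [CommRing A] [Algebra ℚ A]

theorem aeval_bernoulli_eq_sum (n : ℕ) (x : A) :
    Polynomial.aeval x (Polynomial.bernoulli n) =
      ∑ k ∈ range (n + 1), (n.choose k : A) * x ^ k * algebraMap ℚ A (bernoulli (n - k)) := by
  rw [Polynomial.bernoulli_def, map_sum]
  refine sum_congr rfl fun k _ => ?_
  rw [Polynomial.aeval_monomial, map_mul, map_natCast]
  ring

theorem aeval_bernoulli_add_natCast (n k : ℕ) (x : A) :
    Polynomial.aeval (x + k) (Polynomial.bernoulli n) =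
      Polynomial.aeval x (Polynomial.bernoulli n) + n * ∑ r ∈ range k, (x + r) ^ (n - 1) := by
  induction k with
  | zero => simp
  | succ k ih =>
    have h := congrArg (Polynomial.aeval (x + k)) (Polynomial.bernoulli_comp_one_add_X n)
    simp only [Polynomial.aeval_comp, map_add, map_one, Polynomial.aeval_X, map_pow,
      nsmul_eq_mul, map_mul, map_natCast] at h
    rw [sum_range_succ, Nat.cast_succ, show x + ((k : A) + 1) = 1 + (x + k) by ring, h, ih]
    ring

theorem aeval_bernoulli_one_sub {n : ℕ} (hn : Odd n) (x : A) :
    Polynomial.aeval (1 - x) (Polynomial.bernoulli n) =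
      -Polynomial.aeval x (Polynomial.bernoulli n) := by
  have h := congrArg (Polynomial.aeval x) (Polynomial.bernoulli_comp_one_sub_X n)
  simpa [Polynomial.aeval_comp, hn.neg_one_pow] using h

end BernoulliPolynomial

theorem sum_range_two_mul_eq_sum_add_reflect {M : Type*} [AddCommMonoid M] (f : ℕ → M) (a : ℕ) :
    ∑ r ∈ range (2 * a), f r = ∑ r ∈ range a, (f r + f (2 * a - 1 - r)) := by
  rw [two_mul, sum_range_add, ← sum_range_reflect (fun x => f (a + x)), ← sum_add_distrib]
  refine sum_congr rfl fun r hr => ?_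
  rw [mem_range] at hr
  congr 2
  omega

theorem sum_range_two_mul_add_one_eq_sum_add_reflect {M : Type*} [AddCommMonoid M]
    (f : ℕ → M) (a : ℕ) :
    ∑ r ∈ range (2 * a + 1), f r = ∑ r ∈ range a, (f r + f (2 * a - r)) + f a := by
  rw [show 2 * a + 1 = a + 1 + a by ring, sum_range_add, sum_range_succ,
    ← sum_range_reflect (fun x => f (a + 1 + x)), sum_add_distrib, add_right_comm]
  congr 2
  refine sum_congr rfl fun r hr => ?_
  rw [mem_range] at hr
  congr 1
  omega

theorem sum_range_succ_eq_sum_Icc_one {M : Type*} [AddCommMonoid M] (f : ℕ → M) (a : ℕ) :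
    ∑ r ∈ range (a + 1), f r = ∑ r ∈ Icc 1 a, f r + f 0 := by
  rw [sum_range_succ', range_eq_Ico, sum_Ico_add' f 0 a 1, zero_add,
    Ico_add_one_right_eq_Icc]

theorem three_mul_sum_choose_pow_bernoulli (m : ℂ) {n : ℕ} (hn : Odd n) :
    3 * ∑ k ∈ (range (n + 1)).filter (fun k => k % 6 = 3),
        (n.choose k : ℂ) * m ^ k * (bernoulli (n - k) : ℂ) =
      Polynomial.aeval m (Polynomial.bernoulli n) +
        Polynomial.aeval (m * ω) (Polynomial.bernoulli n) +
        Polynomial.aeval (m * ω ^ 2) (Polynomial.bernoulli n) +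
        if (n - 1) % 3 = 0 then 3 / 2 * n * m ^ (n - 1) else 0 := by
  have hn1 : n - 1 ∈ range (n + 1) := by simp
  have hlast := sum_ite_eq_of_mem' (range (n + 1)) (n - 1)
    (fun k => if k % 3 = 0 then 3 / 2 * n * m ^ k else 0) hn1
  rw [← hlast, aeval_bernoulli_eq_sum, aeval_bernoulli_eq_sum, aeval_bernoulli_eq_sum, sum_filter,
    mul_sum, ← sum_add_distrib, ← sum_add_distrib, ← sum_add_distrib]
  refine sum_congr rfl fun k hk => ?_
  rw [mem_range] at hk
  have hω := omega_pow_add_omega_sq_pow k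
  have key (b : ℂ) : (n.choose k : ℂ) * m ^ k * b + n.choose k * (m * ω) ^ k * b +
      n.choose k * (m * ω ^ 2) ^ k * b =
      n.choose k * m ^ k * b * (1 + if k % 3 = 0 then 2 else -1) := by
    rw [← hω, mul_pow, mul_pow]; ring
  rw [key, eq_ratCast]
  obtain ⟨c, rfl⟩ := hn
  by_cases h3 : k % 3 = 0
  · by_cases h6 : k % 6 = 3
    · have : k ≠ 2 * c + 1 - 1 := by omega
      simp only [h3, h6, this, if_true, if_false]
      ring
    · by_cases hl : k = 2 * c + 1 - 1
      · subst hl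
        have hc : (2 * c + 1).choose (2 * c) = 2 * c + 1 := Nat.choose_succ_self_right _
        simp only [Nat.add_sub_cancel] at h3 h6 ⊢
        simp only [h3, h6, if_true, if_false, Nat.add_sub_cancel_left, bernoulli_one, hc]
        push_cast
        ring
      · have hb : bernoulli (2 * c + 1 - k) = 0 :=
          bernoulli_eq_zero_of_odd (by rw [Nat.odd_iff]; omega) (by omega)
        simp only [h6, hl, hb, if_false, Rat.cast_zero, mul_zero, zero_mul, add_zero]
  · have h6 : k % 6 ≠ 3 := by omega
    simp [h3, h6]

theorem aeval_bernoulli_natCast {n : ℕ} (hn : 3 ≤ n) (hodd : Odd n) (m : ℕ) :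
    Polynomial.aeval (m : ℂ) (Polynomial.bernoulli n) =
      n * ∑ r ∈ Icc 1 (m - 1), (r : ℂ) ^ (n - 1) := by
  have h := aeval_bernoulli_add_natCast n m (0 : ℂ)
  have h0 : Polynomial.aeval (0 : ℂ) (Polynomial.bernoulli n) = 0 := by
    rw [← map_zero (algebraMap ℚ ℂ), Polynomial.aeval_algebraMap_apply]
    simp [bernoulli_eq_zero_of_odd hodd (by omega)]
  simp only [zero_add, h0] at h
  rw [h]
  rcases m with _ | m
  · simp
  · rw [sum_range_succ_eq_sum_Icc_one, Nat.cast_zero, zero_pow (by omega), add_zero,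
      Nat.add_sub_cancel]

theorem aeval_bernoulli_mul_omega_add {n : ℕ} (hodd : Odd n) (m : ℕ) :
    Polynomial.aeval (m * ω) (Polynomial.bernoulli n) +
        Polynomial.aeval (m * ω ^ 2) (Polynomial.bernoulli n) =
      -(n * ∑ r ∈ range (m + 1), (r + m * ω) ^ (n - 1)) := by
  have h := aeval_bernoulli_add_natCast n (m + 1) (m * ω)
  have hr := aeval_bernoulli_one_sub hodd (m * ω + (m + 1 : ℕ))
  have he : 1 - (m * ω + (m + 1 : ℕ)) = m * ω ^ 2 := by
    push_cast
    linear_combination (-(m : ℂ)) * omega_sq_add_omega_add_one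
  rw [he] at hr
  rw [hr, h]
  simp only [add_comm (_ * ω)]
  ring

theorem sub_add_mul_omega_pow {N : ℕ} (hN : Even N) {m r : ℕ} (hr : r ≤ m) :
    (((m - r : ℕ) : ℂ) + m * ω) ^ N = (r + m * ω ^ 2) ^ N := by
  rw [← hN.neg_pow, Nat.cast_sub hr]
  congr 1
  linear_combination (-(m : ℂ)) * omega_sq_add_omega_add_one

theorem sum_range_add_mul_omega_pow {N : ℕ} (hN : Even N) {m : ℕ} (hm : 0 < m) :
    ∑ r ∈ range (m + 1), ((r : ℂ) + m * ω) ^ N =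
      ∑ r ∈ Icc 1 ((m - 1) / 2), ((r + m * ω) ^ N + (r + m * ω ^ 2) ^ N) +
        (m : ℂ) ^ N * (if N % 3 = 0 then 2 else -1) +
        if m % 2 = 1 then 0 else (-3 : ℂ) ^ (N / 2) * ((m : ℂ) / 2) ^ N := by
  have hfold : ∑ r ∈ range (m + 1), ((r : ℂ) + m * ω) ^ N =
      ∑ r ∈ range ((m - 1) / 2 + 1), ((r + m * ω) ^ N + (r + m * ω ^ 2) ^ N) +
        if m % 2 = 1 then 0 else ((m / 2 : ℕ) + m * ω) ^ N := by
    rcases Nat.even_or_odd' m with ⟨a, ha | ha⟩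
    · rw [if_neg (by omega), show (m - 1) / 2 + 1 = a by omega, show m / 2 = a by omega,
        show m + 1 = 2 * a + 1 by omega, sum_range_two_mul_add_one_eq_sum_add_reflect]
      congr 1
      refine sum_congr rfl fun r hr => ?_
      rw [mem_range] at hr
      rw [← ha, sub_add_mul_omega_pow hN (by omega)]
    · rw [if_pos (by omega), show (m - 1) / 2 + 1 = a + 1 by omega,
        show m + 1 = 2 * (a + 1) by omega, sum_range_two_mul_eq_sum_add_reflect, add_zero]
      refine sum_congr rfl fun r hr => ?_
      rw [mem_range] at hr
      rw [show 2 * (a + 1) - 1 - r = m - r by omega, sub_add_mul_omega_pow hN (by omega)]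
  rw [hfold, sum_range_succ_eq_sum_Icc_one, ← omega_pow_add_omega_sq_pow, Nat.cast_zero, zero_add,
    zero_add, mul_pow, mul_pow, mul_add]
  congr 1
  split_ifs with h
  · rfl
  · obtain ⟨a, rfl⟩ : 2 ∣ m := by omega
    obtain ⟨b, rfl⟩ := hN.two_dvd
    rw [Nat.mul_div_cancel_left _ two_pos, Nat.mul_div_cancel_left _ two_pos, pow_mul, pow_mul,
      ← mul_pow]
    congr 1
    push_cast
    linear_combination 4 * (a : ℂ) ^ 2 * omega_sq_add_omega_add_one

theorem sum_choose_pow_bernoulli_mod_six (m n : ℕ) (hm : 0 < m) (hn : 3 ≤ n)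
    (hodd : Odd n) :
    ∑ k ∈ (Finset.range (n + 1)).filter (fun k => k % 6 = 3),
      (n.choose k : ℂ) * (m : ℂ) ^ k * (bernoulli (n - k) : ℂ)
    = (n : ℂ) / 3 *
        ((∑ r ∈ Finset.Icc 1 (m - 1), (r : ℂ) ^ (n - 1))
          - (∑ r ∈ Finset.Icc 1 ((m - 1) / 2),
              ((r + m * ω) ^ (n - 1) + (r + m * ω ^ 2) ^ (n - 1)))
          + (if m % 2 = 1 then
              (if (n - 1) % 3 = 0 then -(m : ℂ) ^ (n - 1) / 2 else (m : ℂ) ^ (n - 1))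
            else
              (if (n - 1) % 3 = 0 then
                -(m : ℂ) ^ (n - 1) / 2 - (-3 : ℂ) ^ ((n - 1) / 2) * ((m : ℂ) / 2) ^ (n - 1)
              else
                (m : ℂ) ^ (n - 1) - (-3 : ℂ) ^ ((n - 1) / 2) * ((m : ℂ) / 2) ^ (n - 1)))) := by
  have h := three_mul_sum_choose_pow_bernoulli (m : ℂ) hodd
  rw [add_assoc (Polynomial.aeval _ _), aeval_bernoulli_natCast hn hodd,
    aeval_bernoulli_mul_omega_add hodd,
    sum_range_add_mul_omega_pow (Nat.Odd.sub_odd hodd odd_one) hm] at h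
  split_ifs at h ⊢ <;> linear_combination h / 3
end

section
/- For every positive integer n and every complex number x, Σ_{0 ≤ k ≤ n, k ≡ 2 (mod 4)} C(n,k) B_{n-k}(x) (−1)^{(k-2)/4} 2^{n+1−k/2} = n i ( (2x−1−i)^{n-1} − (2x−1+i)^{n-1} ). -/
open Finset

/-- The Bernoulli polynomial `B_n(x) = ∑_{k=0}^n C(n,k) B_k x^{n-k}`, evaluated at `x : ℂ`,
where `B_k` are the Bernoulli numbers (`B_1 = -1/2`). -/
noncomputable def bernoulliPoly (n : ℕ) (x : ℂ) : ℂ :=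
  ∑ k ∈ Finset.range (n + 1), (bernoulli k : ℂ) * (n.choose k : ℂ) * x ^ (n - k)

theorem bernoulliPoly_eq_aeval (n : ℕ) (x : ℂ) :
    bernoulliPoly n x = Polynomial.aeval x (Polynomial.bernoulli n) := by
  rw [Polynomial.bernoulli_def, map_sum, bernoulliPoly,
    ← Finset.sum_range_reflect]
  refine Finset.sum_congr rfl fun k hk => ?_
  have hk' : k ≤ n := Nat.lt_succ_iff.mp (Finset.mem_range.mp hk)
  simp [Polynomial.aeval_monomial, Nat.choose_symm hk', Nat.sub_sub_self hk']

theorem bernoulliPoly_add_one (n : ℕ) (x : ℂ) :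
    bernoulliPoly n (x + 1) = bernoulliPoly n x + n * x ^ (n - 1) := by
  have h := congrArg (Polynomial.aeval x) (Polynomial.bernoulli_comp_one_add_X n)
  simpa [Polynomial.aeval_comp, ← bernoulliPoly_eq_aeval, add_comm] using h

theorem bernoulliPoly_add (n : ℕ) (x y : ℂ) :
    bernoulliPoly n (x + y) =
      ∑ k ∈ Finset.range (n + 1), (n.choose k : ℂ) * bernoulliPoly (n - k) x * y ^ k := by
  simp only [bernoulliPoly, add_comm x y, add_pow, Finset.mul_sum, Finset.sum_mul]
  rw [Finset.sum_comm' (t' := Finset.range (n + 1)) (s' := fun k => Finset.range (n - k + 1))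
    (by intro a b; simp only [Finset.mem_range]; omega)]
  refine Finset.sum_congr rfl fun k hk => Finset.sum_congr rfl fun j hj => ?_
  rw [Finset.mem_range] at hk hj
  have h : (n.choose j : ℂ) * ((n - j).choose k : ℂ) = n.choose k * (n - k).choose j := by
    have h₁ := Nat.choose_mul (n := n) (k := j + k) (s := j) (by omega)
    have h₂ := Nat.choose_mul (n := n) (k := j + k) (s := k) (by omega)
    rw [Nat.add_sub_cancel_left] at h₁
    rw [Nat.add_sub_cancel] at h₂
    rw [← Nat.choose_symm_add] at h₂
    exact_mod_cast h₁.symm.trans h₂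
  rw [Nat.sub_right_comm n k j]
  linear_combination (bernoulli j : ℂ) * y ^ k * x ^ (n - j - k) * h

theorem alternating_sum_pow_fourth_roots (w : ℂ) (k : ℕ) :
    w ^ k - (Complex.I * w) ^ k + (-w) ^ k - (-(Complex.I * w)) ^ k =
      if k % 4 = 2 then 4 * w ^ k else 0 := by
  have hI : Complex.I ^ 4 = 1 := Complex.I_pow_four
  have hn : (-1 : ℂ) ^ 4 = 1 := by norm_num
  have hk : w ^ k - (Complex.I * w) ^ k + (-w) ^ k - (-(Complex.I * w)) ^ k =
      w ^ k * (1 - Complex.I ^ (k % 4) + (-1) ^ (k % 4)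
        - (-1) ^ (k % 4) * Complex.I ^ (k % 4)) := by
    rw [← pow_eq_pow_mod k hI, ← pow_eq_pow_mod k hn, neg_pow w, neg_pow (Complex.I * w), mul_pow]
    ring
  rw [hk]
  have : k % 4 < 4 := Nat.mod_lt _ (by norm_num)
  interval_cases k % 4 <;> simp [pow_succ, -mul_eq_zero] <;> ring

theorem half_one_add_I_pow (m : ℕ) :
    ((1 + Complex.I) / 2) ^ (4 * m + 2) * 2 ^ (2 * m + 1) = Complex.I * (-1) ^ m := by
  have h : ((1 + Complex.I) / 2) ^ 2 = Complex.I / 2 := by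
    linear_combination Complex.I_sq / 4
  rw [show 4 * m + 2 = 2 * (2 * m + 1) by ring, pow_mul, h, ← mul_pow,
    div_mul_cancel₀ _ two_ne_zero, pow_succ, pow_mul, Complex.I_sq, mul_comm]

theorem sum_choose_bernoulliPoly_mod_four (n : ℕ) (hn : 0 < n) (x : ℂ) :
    ∑ k ∈ (Finset.range (n + 1)).filter (fun k => k % 4 = 2),
      (n.choose k : ℂ) * bernoulliPoly (n - k) x * (-1 : ℂ) ^ ((k - 2) / 4)
        * (2 : ℂ) ^ (n + 1 - k / 2)
    = (n : ℂ) * Complex.I *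
        ((2 * x - 1 - Complex.I) ^ (n - 1) - (2 * x - 1 + Complex.I) ^ (n - 1)) := by
  set w : ℂ := (1 + Complex.I) / 2 with hw
  have hsum : bernoulliPoly n (x + w) - bernoulliPoly n (x + Complex.I * w)
      + bernoulliPoly n (x + -w) - bernoulliPoly n (x + -(Complex.I * w)) =
      ∑ k ∈ (Finset.range (n + 1)).filter (fun k => k % 4 = 2),
        (n.choose k : ℂ) * bernoulliPoly (n - k) x * (4 * w ^ k) := by
    simp only [bernoulliPoly_add, ← Finset.sum_sub_distrib, ← Finset.sum_add_distrib]
    rw [Finset.sum_filter]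
    refine Finset.sum_congr rfl fun k _ => ?_
    rw [← mul_sub, ← mul_add, ← mul_sub, alternating_sum_pow_fourth_roots, mul_ite, mul_zero]
  have h₁ := bernoulliPoly_add_one n (x + Complex.I * w)
  have h₂ := bernoulliPoly_add_one n (x + -w)
  rw [show x + Complex.I * w + 1 = x + w by
    rw [hw]; linear_combination Complex.I_sq / 2] at h₁
  rw [show x + -w + 1 = x + -(Complex.I * w) by
    rw [hw]; linear_combination Complex.I_sq / 2] at h₂
  have hterm : ∀ k ∈ (Finset.range (n + 1)).filter (fun k => k % 4 = 2),
      (n.choose k : ℂ) * bernoulliPoly (n - k) x * (-1 : ℂ) ^ ((k - 2) / 4)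
        * (2 : ℂ) ^ (n + 1 - k / 2) =
      -Complex.I * 2 ^ (n - 1) *
        ((n.choose k : ℂ) * bernoulliPoly (n - k) x * (4 * w ^ k)) := by
    intro k hk
    rw [Finset.mem_filter, Finset.mem_range] at hk
    obtain ⟨m, rfl⟩ : ∃ m, k = 4 * m + 2 := ⟨k / 4, by omega⟩
    have hp : (2 : ℂ) ^ (n - 1) * 4 = 2 ^ (n + 1 - (4 * m + 2) / 2) * 2 ^ (2 * m + 1) := by
      rw [show (4 : ℂ) = 2 ^ 2 by norm_num, ← pow_add, ← pow_add]
      congr 1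
      omega
    have hm := half_one_add_I_pow m
    rw [← hw] at hm
    rw [show (4 * m + 2 - 2) / 4 = m by omega]
    set c : ℂ := (n.choose (4 * m + 2) : ℂ) * bernoulliPoly (n - (4 * m + 2)) x
    set p : ℂ := 2 ^ (n + 1 - (4 * m + 2) / 2)
    linear_combination Complex.I * c * w ^ (4 * m + 2) * hp + Complex.I * c * p * hm
      + c * p * (-1) ^ m * Complex.I_sq
  rw [Finset.sum_congr rfl hterm, ← Finset.mul_sum, ← hsum]
  have h₃ : (2 * x - 1 + Complex.I) ^ (n - 1) = 2 ^ (n - 1) * (x + Complex.I * w) ^ (n - 1) := by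
    rw [← mul_pow, hw]
    congr 1
    linear_combination -Complex.I_sq
  have h₄ : (2 * x - 1 - Complex.I) ^ (n - 1) = 2 ^ (n - 1) * (x + -w) ^ (n - 1) := by
    rw [← mul_pow, hw]
    congr 1
    ring
  rw [h₃, h₄]
  linear_combination -Complex.I * 2 ^ (n - 1) * (h₁ - h₂)
end
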